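/- For n agents, the number of distinct undirected consumption graphs of fractionally Pareto-optimal allocations is at most 3^{(1+D(v))·n(n−1)/2} · m^{n(n−1)/2}. -/

import Mathlib

open Finset

/-- An allocation: nonnegative matrix with column sums 1. -/
def IsAllocation {n m : ℕ} (z : Fin n → Fin m → ℝ) : Prop :=
  (∀ i o, 0 ≤ z i o) ∧ ∀ o, ∑ i, z i o = 1

/-- Additive utility of agent `i` at allocation `z`. -/
def utility {n m : ℕ} (v z : Fin n → Fin m → ℝ) (i : Fin n) : ℝ :=
  ∑ o, v i o * z i o

/-- Fractional Pareto optimality: no feasible allocation weakly improves everyone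
and strictly improves someone. -/
def IsFPO {n m : ℕ} (v z : Fin n → Fin m → ℝ) : Prop :=
  ¬ ∃ y, IsAllocation y ∧ (∀ i, utility v z i ≤ utility v y i) ∧
    ∃ i, utility v z i < utility v y i

/-- Number of sharings of allocation `z`. -/
noncomputable def sharings {n m : ℕ} (z : Fin n → Fin m → ℝ) : ℕ :=
  ∑ o : Fin m, ((Finset.univ.filter (fun i : Fin n => 0 < z i o)).card - 1)

open Filter Topology in
/-- In a fractionally Pareto-optimal allocation, no infinitesimal transfer `d` of objects from
agent `i` to agent `j` is a Pareto improvement. -/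
lemma IsFPO.not_improving_transfer {n m : ℕ} {v z : Fin n → Fin m → ℝ} (hz : IsAllocation z)
    (hfpo : IsFPO v z) {i j : Fin n} (hij : i ≠ j) (d : Fin m → ℝ)
    (hdi : ∀ o, 0 < d o → 0 < z i o) (hdj : ∀ o, d o < 0 → 0 < z j o)
    (hi : ∑ o, v i o * d o ≤ 0) (hj : 0 ≤ ∑ o, v j o * d o) :
    ∑ o, v i o * d o = 0 ∧ ∑ o, v j o * d o = 0 := by
  have key : ∀ c e : ℝ, 0 ≤ c → (e < 0 → 0 < c) → ∀ᶠ ε : ℝ in 𝓝[>] 0, 0 ≤ c + ε * e := by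
    intro c e hc he
    rcases lt_or_ge e 0 with h | h
    · have hcont : Tendsto (fun ε : ℝ => c + ε * e) (𝓝[>] 0) (𝓝 (c + 0 * e)) :=
        (Continuous.tendsto (by fun_prop) 0).mono_left nhdsWithin_le_nhds
      rw [zero_mul, add_zero] at hcont
      filter_upwards [hcont.eventually (lt_mem_nhds (he h))] with ε hε using hε.le
    · filter_upwards [self_mem_nhdsWithin] with ε hε
      have : (0 : ℝ) < ε := hε
      positivity
  have hev : ∀ᶠ ε : ℝ in 𝓝[>] 0, ∀ o, 0 ≤ z i o + ε * (-d o) ∧ 0 ≤ z j o + ε * d o :=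
    eventually_all.2 fun o =>
      (key _ _ (hz.1 i o) fun h => hdi o (by linarith)).and (key _ _ (hz.1 j o) (hdj o))
  obtain ⟨ε, hε, hε0⟩ := (hev.and self_mem_nhdsWithin).exists
  have hε0 : (0 : ℝ) < ε := hε0
  let c : Fin n → ℝ := Pi.single j 1 - Pi.single i 1
  have hci : c i = -1 := by simp [c, hij]
  have hcj : c j = 1 := by simp [c, hij.symm]
  have hck : ∀ k, k ≠ i → k ≠ j → c k = 0 := fun k h h' => by simp [c, h, h']
  let y : Fin n → Fin m → ℝ := fun k o => z k o + ε * (c k * d o)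
  have hu : ∀ k, utility v y k = utility v z k + ε * (c k * ∑ o, v k o * d o) := by
    intro k
    simp only [utility, y, Finset.mul_sum, ← Finset.sum_add_distrib]
    exact Finset.sum_congr rfl fun o _ => by ring
  have hy : IsAllocation y := by
    refine ⟨fun k o => ?_, fun o => ?_⟩
    · by_cases hki : k = i
      · subst hki
        simpa [y, hci] using (hε o).1
      by_cases hkj : k = j
      · subst hkj
        simpa [y, hcj] using (hε o).2
      simpa [y, hck k hki hkj] using hz.1 k o
    · have hc : ∑ k, c k = 0 := by simp [c]
      simp only [y, Finset.sum_add_distrib, hz.2 o, ← Finset.mul_sum, ← Finset.sum_mul, hc]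
      simp
  have hweak : ∀ k, utility v z k ≤ utility v y k := by
    intro k
    rw [hu, le_add_iff_nonneg_right]
    refine mul_nonneg hε0.le ?_
    by_cases hki : k = i
    · subst hki
      rw [hci]; linarith
    by_cases hkj : k = j
    · subst hkj
      rw [hcj]; linarith
    simp [hck k hki hkj]
  have hstrict : ∀ k, ¬ 0 < c k * ∑ o, v k o * d o := fun k hk =>
    hfpo ⟨y, hy, hweak, k, by rw [hu]; linarith [mul_pos hε0 hk]⟩
  have h1 := hstrict i
  have h2 := hstrict j
  rw [hci] at h1
  rw [hcj] at h2
  constructor <;> linarith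

/-- Finitely many homogeneous constraints `x s + r * y s ≤ 0` on a positive number `r` are
satisfiable as soon as no nonnegative combination of two of the vectors `(x s, y s)` is
nonnegative and nonzero. -/
lemma exists_pos_forall_add_mul_nonpos {ι : Type*} [Finite ι] (x y : ι → ℝ)
    (h : ∀ s t : ι, ∀ p q : ℝ, 0 ≤ p → 0 ≤ q → 0 ≤ p * x s + q * x t → 0 ≤ p * y s + q * y t →
      p * x s + q * x t = 0 ∧ p * y s + q * y t = 0) :
    ∃ r : ℝ, 0 < r ∧ ∀ s, x s + r * y s ≤ 0 := by
  classical
  have := Fintype.ofFinite ι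
  have single : ∀ s, 0 ≤ x s → 0 ≤ y s → x s = 0 ∧ y s = 0 := by
    intro s hx hy
    simpa using h s s 1 0 zero_le_one le_rfl (by simpa using hx) (by simpa using hy)
  by_cases hU : (Finset.univ.filter fun s => 0 < y s).Nonempty
  · obtain ⟨s, hs, hmin⟩ := Finset.exists_min_image _ (fun s => -x s / y s) hU
    have hs : 0 < y s := by simpa using hs
    have hxs : x s < 0 := by
      by_contra! hx
      exact hs.ne' (single s hx hs.le).2
    refine ⟨-x s / y s, div_pos (by linarith) hs, fun t => ?_⟩
    rcases lt_trichotomy (y t) 0 with ht | ht | ht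
    · by_contra! hc
      have hc' : 0 < (x t + -x s / y s * y t) * y s := mul_pos hc hs
      have e : (x t + -x s / y s * y t) * y s = -y t * x s + y s * x t := by
        field_simp
        ring
      rw [e] at hc'
      exact hc'.ne' (h s t (-y t) (y s) (by linarith) hs.le hc'.le (by linarith)).1
    · rw [ht, mul_zero, add_zero]
      by_contra! hc
      exact hc.ne' (single t hc.le ht.ge).1
    · have := (le_div_iff₀ ht).1 (hmin t (by simpa using ht))
      linarith
  · have hU : ∀ s, y s ≤ 0 := by
      simpa [Finset.not_nonempty_iff_eq_empty, Finset.filter_eq_empty_iff] using hU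
    obtain ⟨M, hM⟩ := (Set.finite_range fun s => x s / -y s).bddAbove
    refine ⟨max 1 M, by positivity, fun t => ?_⟩
    rcases (hU t).lt_or_eq with ht | ht
    · have h1 : x t / -y t ≤ max 1 M := (hM ⟨t, rfl⟩).trans (le_max_right _ _)
      rw [div_le_iff₀ (by linarith)] at h1
      linarith
    · rw [ht, mul_zero, add_zero]
      by_contra! hc
      exact hc.ne' (single t hc.le ht.ge).1

/-- In a fractionally Pareto-optimal allocation, every pair of agents admits an exchange rate
supporting what these two agents consume. -/
lemma IsFPO.exists_exchange_rate {n m : ℕ} {v z : Fin n → Fin m → ℝ} (hz : IsAllocation z)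
    (hfpo : IsFPO v z) {i j : Fin n} (hij : i ≠ j) :
    ∃ r : ℝ, 0 < r ∧ ∀ o, (0 < z i o → r * v j o ≤ v i o) ∧ (0 < z j o → v i o ≤ r * v j o) := by
  let ι := {o // 0 < z i o} ⊕ {o // 0 < z j o}
  let d : ι → Fin m → ℝ := Sum.elim (fun o => Pi.single o.1 1) (fun o => Pi.single o.1 (-1))
  have hdi : ∀ s o, 0 < d s o → 0 < z i o := by
    rintro (⟨o', ho'⟩ | ⟨o', ho'⟩) o <;> by_cases hoo : o = o' <;>
      simp_all [d]
  have hdj : ∀ s o, d s o < 0 → 0 < z j o := by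
    rintro (⟨o', ho'⟩ | ⟨o', ho'⟩) o <;> by_cases hoo : o = o' <;>
      simp_all [d]
  obtain ⟨r, hr, hs⟩ := exists_pos_forall_add_mul_nonpos (fun s : ι => -∑ o, v i o * d s o)
    (fun s => ∑ o, v j o * d s o) (by
      intro s t p q hp hq hx hy
      have hsum : ∀ k, ∑ o, v k o * (p * d s o + q * d t o) =
          p * ∑ o, v k o * d s o + q * ∑ o, v k o * d t o := by
        intro k
        simp only [Finset.mul_sum, ← Finset.sum_add_distrib]
        exact Finset.sum_congr rfl fun o _ => by ring
      have := hfpo.not_improving_transfer hz hij (fun o => p * d s o + q * d t o)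
        (fun o ho => by
          by_contra hc
          have h1 : d s o ≤ 0 := not_lt.1 fun h => hc (hdi s o h)
          have h2 : d t o ≤ 0 := not_lt.1 fun h => hc (hdi t o h)
          nlinarith [mul_nonneg hp (neg_nonneg.2 h1), mul_nonneg hq (neg_nonneg.2 h2)])
        (fun o ho => by
          by_contra hc
          have h1 : 0 ≤ d s o := not_lt.1 fun h => hc (hdj s o h)
          have h2 : 0 ≤ d t o := not_lt.1 fun h => hc (hdj t o h)
          nlinarith [mul_nonneg hp h1, mul_nonneg hq h2])
        (by rw [hsum]; linarith) (by rw [hsum]; linarith)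
      rw [hsum, hsum] at this
      exact ⟨by linarith [this.1], this.2⟩)
  refine ⟨r, hr, fun o => ⟨fun ho => ?_, fun ho => ?_⟩⟩
  · have := hs (Sum.inl ⟨o, ho⟩)
    simp [d, Pi.single_apply] at this
    linarith
  · have := hs (Sum.inr ⟨o, ho⟩)
    simp [d, Pi.single_apply] at this
    linarith

/-- The two-agent sharing patterns supported by the exchange rate `r`: an object goes to the
first agent (`0`), to the second agent (`1`), or, only if the agents are tied, to both (`2`). -/
noncomputable def ratePatterns {m : ℕ} (a b : Fin m → ℝ) (r : ℝ) : Finset (Fin m → Fin 3) :=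
  Fintype.piFinset fun o => if r * b o < a o then {0} else if a o < r * b o then {1} else univ

lemma mem_ratePatterns {m : ℕ} {a b : Fin m → ℝ} {r : ℝ} {h : Fin m → Fin 3} :
    h ∈ ratePatterns a b r ↔
      ∀ o, (r * b o < a o → h o = 0) ∧ (a o < r * b o → h o = 1) := by
  rw [ratePatterns, Fintype.mem_piFinset]
  refine forall_congr' fun o => ?_
  rcases lt_trichotomy (r * b o) (a o) with ho | ho | ho
  · simp [ho, ho.not_gt]
  · simp [ho]
  · simp [ho, ho.not_gt]

lemma card_ratePatterns {m : ℕ} (a b : Fin m → ℝ) (r : ℝ) :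
    (ratePatterns a b r).card = 3 ^ (univ.filter fun o => a o = r * b o).card := by
  rw [ratePatterns, Fintype.card_piFinset, ← Finset.prod_const, Finset.prod_filter]
  refine Finset.prod_congr rfl fun o _ => ?_
  rcases lt_trichotomy (r * b o) (a o) with ho | ho | ho
  · simp [ho, ho.ne']
  · simp [ho]
  · simp [ho, ho.not_gt, ho.ne]

/-- Every positive exchange rate may be replaced by one of at most `m` critical ones. -/
lemma exists_critical_rates {m : ℕ} (hm : 0 < m) (a b : Fin m → ℝ) :
    ∃ S : Finset ℝ, S.card ≤ m ∧ (∀ s ∈ S, 0 < s) ∧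
      ∀ r, 0 < r → ∃ s ∈ S, ratePatterns a b r ⊆ ratePatterns a b s := by
  classical
  let R : Finset ℝ := (univ.image fun o => a o / b o).filter (0 < ·)
  have hR : R.card ≤ m :=
    (Finset.card_filter_le _ _).trans (Finset.card_image_le.trans (by simp))
  -- A comparison that changes between two positive rates has a critical rate in between.
  have cross : ∀ r s : ℝ, 0 < r → 0 < s → (∀ c ∈ R, |s - r| ≤ |c - r|) →
      ratePatterns a b r ⊆ ratePatterns a b s := by
    intro r s hr hs hmin h hh
    rw [mem_ratePatterns] at hh ⊢
    have aux : ∀ o, 0 < (a o - s * b o) * b o → (a o - r * b o) * b o ≤ 0 → False := by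
      intro o h1 h2
      have hb : 0 < b o * b o := by
        rcases eq_or_ne (b o) 0 with hb | hb
        · simp [hb] at h1
        · exact mul_self_pos.2 hb
      have e : a o / b o * (b o * b o) = a o * b o := by
        have : b o ≠ 0 := fun h => by simp [h] at hb
        field_simp
      have c1 : s < a o / b o := by
        by_contra! hc
        nlinarith [mul_le_mul_of_nonneg_right hc hb.le]
      have c2 : a o / b o ≤ r := by
        by_contra! hc
        nlinarith [mul_lt_mul_of_pos_right hc hb]
      have := hmin (a o / b o) (by simp [R]; exact hs.trans c1)
      rw [abs_of_nonpos (by linarith), abs_of_nonpos (by linarith)] at this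
      linarith
    have aux' : ∀ o, (a o - s * b o) * b o < 0 → 0 ≤ (a o - r * b o) * b o → False := by
      intro o h1 h2
      have hb : 0 < b o * b o := by
        rcases eq_or_ne (b o) 0 with hb | hb
        · simp [hb] at h1
        · exact mul_self_pos.2 hb
      have e : a o / b o * (b o * b o) = a o * b o := by
        have : b o ≠ 0 := fun h => by simp [h] at hb
        field_simp
      have c1 : a o / b o < s := by
        by_contra! hc
        nlinarith [mul_le_mul_of_nonneg_right hc hb.le]
      have c2 : r ≤ a o / b o := by
        by_contra! hc
        nlinarith [mul_lt_mul_of_pos_right hc hb]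
      have := hmin (a o / b o) (by simp [R]; exact hr.trans_le c2)
      rw [abs_of_nonneg (by linarith), abs_of_nonneg (by linarith)] at this
      linarith
    refine fun o => ⟨fun ho => (hh o).1 ?_, fun ho => (hh o).2 ?_⟩
    · by_contra! hc
      rcases lt_trichotomy (b o) 0 with hb | hb | hb
      · exact aux' o (by nlinarith) (by nlinarith)
      · rw [hb] at ho hc; linarith
      · exact aux o (by nlinarith) (by nlinarith)
    · by_contra! hc
      rcases lt_trichotomy (b o) 0 with hb | hb | hb
      · exact aux o (by nlinarith) (by nlinarith)
      · rw [hb] at ho hc; linarith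
      · exact aux' o (by nlinarith) (by nlinarith)
  rcases R.eq_empty_or_nonempty with hE | hN
  · exact ⟨{1}, (Finset.card_singleton _).trans_le hm, by simp, fun r hr =>
      ⟨1, by simp, cross r 1 hr one_pos (by simp [hE])⟩⟩
  · refine ⟨R, hR, fun s hs => (Finset.mem_filter.1 hs).2, fun r hr => ?_⟩
    obtain ⟨s, hs, hmin⟩ := R.exists_min_image (fun c => |c - r|) hN
    exact ⟨s, hs, cross r s hr (Finset.mem_filter.1 hs).2 hmin⟩

lemma exists_finset_ratePatterns_subset {m D : ℕ} (hm : 0 < m) (a b : Fin m → ℝ)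
    (hD : ∀ r : ℝ, 0 < r → (univ.filter fun o => a o = r * b o).card ≤ D + 1) :
    ∃ T : Finset (Fin m → Fin 3), T.card ≤ 3 ^ (1 + D) * m ∧
      ∀ r, 0 < r → ratePatterns a b r ⊆ T := by
  classical
  obtain ⟨S, hS, hpos, hsub⟩ := exists_critical_rates hm a b
  refine ⟨S.biUnion (ratePatterns a b), ?_, fun r hr => ?_⟩
  · calc (S.biUnion (ratePatterns a b)).card
        ≤ S.card * 3 ^ (1 + D) := Finset.card_biUnion_le_card_mul _ _ _ fun s hs => by
          rw [card_ratePatterns, add_comm]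
          exact Nat.pow_le_pow_right (by norm_num) (hD s (hpos s hs))
      _ ≤ 3 ^ (1 + D) * m := by rw [mul_comm]; gcongr
  · obtain ⟨s, hs, h⟩ := hsub r hr
    exact h.trans (Finset.subset_biUnion_of_mem _ hs)

/-- For n agents, the number of undirected consumption graphs of fPO allocations is
at most 3^{(1+D)·n(n-1)/2} · m^{n(n-1)/2}. -/
theorem stmt15 {n m : ℕ} (hm : 0 < m) (v : Fin n → Fin m → ℝ) (D : ℕ)
    (hD : ∀ i j : Fin n, i ≠ j → ∀ r : ℝ, 0 < r →
      (Finset.univ.filter (fun o : Fin m => v i o = r * v j o)).card ≤ D + 1) :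
    Set.ncard {g : Fin n → Fin m → Bool |
        ∃ z, IsAllocation z ∧ IsFPO v z ∧ ∀ i o, g i o = true ↔ 0 < z i o}
      ≤ 3 ^ ((1 + D) * (n * (n - 1) / 2)) * m ^ (n * (n - 1) / 2) := by
  classical
  let P := Σ j : Fin n, Finset.Iio j
  have hne : ∀ p : P, (p.2 : Fin n) ≠ p.1 := fun p => (Finset.mem_Iio.1 p.2.2).ne
  choose T hTcard hT using fun p : P =>
    exists_finset_ratePatterns_subset hm (v p.2) (v p.1) (hD _ _ (hne p))
  have hcardP : Fintype.card P = n * (n - 1) / 2 := by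
    simp only [P, Fintype.card_sigma, Fintype.card_coe, Fin.card_Iio]
    rw [Fin.sum_univ_eq_sum_range (fun i => i), Finset.sum_range_id]
  have hcard : (Fintype.piFinset T).card ≤
      3 ^ ((1 + D) * (n * (n - 1) / 2)) * m ^ (n * (n - 1) / 2) := by
    rw [Fintype.card_piFinset, pow_mul, ← mul_pow, ← hcardP, ← Finset.card_univ]
    exact Finset.prod_le_pow_card _ _ _ fun p _ => hTcard p
  set G := {g : Fin n → Fin m → Bool |
    ∃ z, IsAllocation z ∧ IsFPO v z ∧ ∀ i o, g i o = true ↔ 0 < z i o}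
  have hcover : ∀ g ∈ G, ∀ o, ∃ i, g i o = true := by
    rintro g ⟨z, hz, -, hg⟩ o
    by_contra! hc
    have h0 : ∑ i, z i o ≤ 0 := Finset.sum_nonpos fun i _ => not_lt.1 fun h => hc i ((hg i o).2 h)
    rw [hz.2 o] at h0
    linarith
  have hcode : ∀ g ∈ G, ∃ e ∈ Fintype.piFinset T, ∀ p : P, ∀ o,
      (g p.2 o = true → e p o ≠ 1) ∧ (g p.1 o = true → e p o ≠ 0) ∧
      (g p.2 o = true → g p.1 o = false → e p o = 0) ∧
      (g p.1 o = true → g p.2 o = false → e p o = 1) := by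
    rintro g ⟨z, hz, hfpo, hg⟩
    choose r hr hrate using fun p : P => hfpo.exists_exchange_rate hz (hne p)
    refine ⟨fun p o => if g p.1 o then (if g p.2 o then 2 else 1) else
      if g p.2 o ∨ ¬ v p.2 o < r p * v p.1 o then 0 else 1, ?_, fun p o => ?_⟩
    · refine Fintype.mem_piFinset.2 fun p => hT p (r p) (hr p) (mem_ratePatterns.2 fun o => ?_)
      have h1 := (hrate p o).1
      have h2 := (hrate p o).2
      rw [← hg] at h1 h2
      constructor <;> intro ho
      · have hj : ¬ g p.1 o = true := fun h => (h2 h).not_gt ho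
        rw [if_neg hj, if_pos (Or.inr ho.not_gt)]
      · have hi : ¬ g p.2 o = true := fun h => (h1 h).not_gt ho
        simp [hi, ho]
    · cases h1 : g p.1 o <;> cases h2 : g p.2 o <;> simp [h1, h2]
  choose! e heT he using hcode
  have hle : ∀ g ∈ G, ∀ g' ∈ G, e g = e g' → ∀ i o, g i o = true → g' i o = true := by
    intro g hgG g' hgG' hee i o hi
    by_contra hi'
    rw [Bool.not_eq_true] at hi'
    obtain ⟨j, hj⟩ := hcover g' hgG' o
    rcases lt_trichotomy i j with hij | rfl | hij
    · let p : P := ⟨j, i, Finset.mem_Iio.2 hij⟩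
      have h1 := (he g hgG p o).1 hi
      rw [hee] at h1
      exact h1 ((he g' hgG' p o).2.2.2 hj hi')
    · simp [hj] at hi'
    · let p : P := ⟨i, j, Finset.mem_Iio.2 hij⟩
      have h1 := (he g hgG p o).2.1 hi
      rw [hee] at h1
      exact h1 ((he g' hgG' p o).2.2.1 hj hi')
  refine le_trans ?_ hcard
  rw [← Set.ncard_coe_finset]
  refine Set.ncard_le_ncard_of_injOn e (fun g hg => heT g hg) (fun g hg g' hg' hee => ?_)
    (Finset.finite_toSet _)
  funext i o
  exact Bool.eq_iff_iff.2 ⟨hle g hg g' hg' hee i o, hle g' hg' g hg hee.symm i o⟩
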